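/- For every natural number n ≥ 11 there exists a graph G on n vertices that is maxnil but is not maximal without a K_6 minor. -/

import Mathlib

open SimpleGraph

/-- `H` is a minor of `G`: there is a family of nonempty, pairwise disjoint,
connected branch sets in `G`, one for each vertex of `H`, with an edge of `G`
between the branch sets of any two adjacent vertices of `H`. -/
def IsMinor {W V : Type} (H : SimpleGraph W) (G : SimpleGraph V) : Prop :=
  ∃ f : W → Set V,
    (∀ w, (f w).Nonempty) ∧
    (∀ w, (G.induce (f w)).Connected) ∧
    (Pairwise fun w₁ w₂ => Disjoint (f w₁) (f w₂)) ∧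
    ∀ ⦃w₁ w₂⦄, H.Adj w₁ w₂ → ∃ v₁ ∈ f w₁, ∃ v₂ ∈ f w₂, G.Adj v₁ v₂

/-- The result of a `∇Y`-move on the triangle `a b c` of `G`: delete the edges of
the triangle and add a new vertex (`none`) joined to `a`, `b`, `c`. -/
def triangleY {V : Type} (G : SimpleGraph V) (a b c : V) : SimpleGraph (Option V) :=
  (SimpleGraph.map Function.Embedding.some
      (G.deleteEdges {s(a, b), s(b, c), s(a, c)})) ⊔
    SimpleGraph.fromEdgeSet {s((none : Option V), some a), s(none, some b), s(none, some c)}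

/-- Membership in the Petersen family: the graphs obtained from `K₆` by
`∇Y`-moves and `Y∇`-moves (the inverse operation), up to isomorphism. -/
inductive IsPetersenFamily : ∀ {V : Type}, SimpleGraph V → Prop
  | k6 : IsPetersenFamily (⊤ : SimpleGraph (Fin 6))
  | deltaY {V : Type} {G : SimpleGraph V} {a b c : V} :
      IsPetersenFamily G → G.Adj a b → G.Adj b c → G.Adj a c →
      IsPetersenFamily (triangleY G a b c)
  | yDelta {V : Type} {G : SimpleGraph V} {a b c : V} :
      IsPetersenFamily (triangleY G a b c) → G.Adj a b → G.Adj b c → G.Adj a c →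
      IsPetersenFamily G
  | iso {V W : Type} {G : SimpleGraph V} {H : SimpleGraph W} :
      IsPetersenFamily G → G ≃g H → IsPetersenFamily H

/-- A graph is linklessly embeddable (nIL) iff it has no minor in the Petersen family. -/
def IsLinkless {V : Type} (G : SimpleGraph V) : Prop :=
  ∀ ⦃W : Type⦄ (P : SimpleGraph W), IsPetersenFamily P → ¬ IsMinor P G

/-- The graph obtained from `G` by adding the edge `ab`. -/
def addEdge {V : Type} (G : SimpleGraph V) (a b : V) : SimpleGraph V :=
  G ⊔ SimpleGraph.fromEdgeSet {s(a, b)}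

/-- A nIL graph is maxnil if adding any edge yields a graph that is not nIL. -/
def IsMaxnil {V : Type} (G : SimpleGraph V) : Prop :=
  IsLinkless G ∧ ∀ a b : V, a ≠ b → ¬ G.Adj a b → ¬ IsLinkless (addEdge G a b)

/-- `S` is a vertex cut set of the connected graph `G` if `G - S` is disconnected. -/
def IsVertexCut {V : Type} (G : SimpleGraph V) (S : Set V) : Prop :=
  G.Connected ∧ ¬ (G.induce Sᶜ).Preconnected

/-- A vertex cut set is minimal if no proper subset of it is a vertex cut set. -/
def IsMinimalVertexCut {V : Type} (G : SimpleGraph V) (S : Set V) : Prop :=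
  IsVertexCut G S ∧ ∀ S' ⊂ S, ¬ IsVertexCut G S'

/-- A set `T` of vertices of `H` (inducing a `K₄`) is strongly separating if `H - T`
has at least two connected components such that every vertex of `T` has a
neighbor in each of them. -/
def StronglySeparating {V : Type} (H : SimpleGraph V) (T : Set V) : Prop :=
  ∃ C₁ C₂ : (H.induce Tᶜ).ConnectedComponent, C₁ ≠ C₂ ∧
    ∀ v ∈ T, (∃ u ∈ C₁.supp, H.Adj v ↑u) ∧ (∃ u ∈ C₂.supp, H.Adj v ↑u)

/-- `G` is maximal without a `K₆` minor. -/
def IsMaximalK6MinorFree {V : Type} (G : SimpleGraph V) : Prop :=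
  ¬ IsMinor (⊤ : SimpleGraph (Fin 6)) G ∧
    ∀ a b : V, a ≠ b → ¬ G.Adj a b → IsMinor (⊤ : SimpleGraph (Fin 6)) (addEdge G a b)

/-! ### Models of minors -/

/-- `f` is a model of `H` as a minor of `G`. -/
def IsModel {W V : Type} (H : SimpleGraph W) (G : SimpleGraph V) (f : W → Set V) : Prop :=
  (∀ w, (f w).Nonempty) ∧
    (∀ w, (G.induce (f w)).Connected) ∧
    (Pairwise fun w₁ w₂ => Disjoint (f w₁) (f w₂)) ∧
    ∀ ⦃w₁ w₂⦄, H.Adj w₁ w₂ → ∃ v₁ ∈ f w₁, ∃ v₂ ∈ f w₂, G.Adj v₁ v₂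

/-- Adjacency inside a set. -/
def Stp {V : Type} (G : SimpleGraph V) (s : Set V) (x y : V) : Prop :=
  G.Adj x y ∧ x ∈ s ∧ y ∈ s

/-- Path-connectedness of a set by chains of adjacent elements. -/
def Lnk {V : Type} (G : SimpleGraph V) (s : Set V) : V → V → Prop :=
  Relation.ReflTransGen (Stp G s)

theorem Lnk.symm {V : Type} {G : SimpleGraph V} {s : Set V} {x y : V} (h : Lnk G s x y) :
    Lnk G s y x := by
  induction h with
  | refl => exact Relation.ReflTransGen.refl
  | tail _ h2 ih =>
    exact Relation.ReflTransGen.head ⟨h2.1.symm, h2.2.2, h2.2.1⟩ ih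

theorem conn_iff {V : Type} (G : SimpleGraph V) (s : Set V) :
    (G.induce s).Connected ↔ s.Nonempty ∧ ∀ x ∈ s, ∀ y ∈ s, Lnk G s x y := by
  constructor
  · intro h
    obtain ⟨x⟩ := h.nonempty
    refine ⟨⟨x.1, x.2⟩, fun x hx y hy => ?_⟩
    have h1 := h.preconnected ⟨x, hx⟩ ⟨y, hy⟩
    rw [SimpleGraph.reachable_iff_reflTransGen] at h1
    exact Relation.ReflTransGen.lift (p := Stp G s) Subtype.val
      (fun a b hab => ⟨hab, a.2, b.2⟩) _ _ h1
  · rintro ⟨⟨x, hx⟩, h⟩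
    have key : ∀ x y (hx : x ∈ s) (_ : Lnk G s x y) (hy : y ∈ s),
        (G.induce s).Reachable ⟨x, hx⟩ ⟨y, hy⟩ := by
      intro x y hx hl
      induction hl with
      | refl => intro _; exact SimpleGraph.Reachable.refl _
      | tail _ h2 ih =>
        intro hy
        refine (ih h2.2.1).trans (SimpleGraph.Adj.reachable ?_)
        exact h2.1
    have : Nonempty s := ⟨⟨x, hx⟩⟩
    exact ⟨fun a b => key a.1 b.1 a.2 (h _ a.2 _ b.2) b.2⟩

theorem conn_of_root {V : Type} {G : SimpleGraph V} {s : Set V} (r : V) (hr : r ∈ s)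
    (h : ∀ y ∈ s, Lnk G s r y) : (G.induce s).Connected :=
  (conn_iff G s).2 ⟨⟨r, hr⟩, fun x hx y hy => (h x hx).symm.trans (h y hy)⟩

theorem exists_nbr {V : Type} {G : SimpleGraph V} {s : Set V} (hc : (G.induce s).Connected)
    {x y : V} (hx : x ∈ s) (hy : y ∈ s) (hne : x ≠ y) : ∃ z ∈ s, G.Adj x z := by
  have h := ((conn_iff G s).1 hc).2 x hx y hy
  rcases Relation.ReflTransGen.cases_head h with h | ⟨z, hz, _⟩
  · exact absurd h hne
  · exact ⟨z, hz.2.2, hz.1⟩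

theorem conn_image {V V' : Type} {G : SimpleGraph V} {G' : SimpleGraph V'} {s : Set V}
    (hc : (G.induce s).Connected) (φ : V → V')
    (hφ : ∀ x ∈ s, ∀ y ∈ s, G.Adj x y → φ x = φ y ∨ G'.Adj (φ x) (φ y)) :
    (G'.induce (Set.image φ s)).Connected := by
  obtain ⟨⟨r, hr⟩, h⟩ := (conn_iff G s).1 hc
  refine conn_of_root (φ r) ⟨r, hr, rfl⟩ ?_
  rintro _ ⟨y, hy, rfl⟩
  have := h r hr y hy
  induction this with
  | refl => exact Relation.ReflTransGen.refl
  | tail _ h2 ih =>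
    have ih' := ih h2.2.1
    rcases hφ _ h2.2.1 _ h2.2.2 h2.1 with e | e
    · rw [← e]; exact ih'
    · exact Relation.ReflTransGen.tail ih' ⟨e, ⟨_, h2.2.1, rfl⟩, ⟨_, h2.2.2, rfl⟩⟩

theorem IsModel.map {W V V' : Type} {P : SimpleGraph W} {G : SimpleGraph V}
    {G' : SimpleGraph V'} {f : W → Set V} (hf : IsModel P G f) (φ : V → V')
    (hφ : ∀ w w', ∀ x ∈ f w, ∀ y ∈ f w', G.Adj x y → φ x = φ y ∨ G'.Adj (φ x) (φ y))
    (hd : ∀ w w', w ≠ w' → ∀ x ∈ f w, ∀ y ∈ f w', φ x ≠ φ y) :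
    IsModel P G' (fun w => Set.image φ (f w)) := by
  obtain ⟨h1, h2, h3, h4⟩ := hf
  refine ⟨fun w => (h1 w).image φ, fun w => conn_image (h2 w) φ (hφ w w), ?_, ?_⟩
  · intro w w' hne
    rw [Set.disjoint_left]
    rintro _ ⟨x, hx, rfl⟩ ⟨y, hy, e⟩
    exact hd w w' hne x hx y hy e.symm
  · intro w w' hww
    obtain ⟨x, hx, y, hy, hxy⟩ := h4 hww
    refine ⟨φ x, ⟨x, hx, rfl⟩, φ y, ⟨y, hy, rfl⟩, ?_⟩
    rcases hφ w w' x hx y hy hxy with e | e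
    · exact absurd e (hd w w' hww.ne x hx y hy)
    · exact e

theorem IsModel.eq_of_mem {W V : Type} {P : SimpleGraph W} {G : SimpleGraph V}
    {f : W → Set V} (hf : IsModel P G f) {w w' : W} {x : V} (h : x ∈ f w) (hh : x ∈ f w') :
    w = w' := by
  by_contra hne
  exact Set.disjoint_left.1 (hf.2.2.1 hne) h hh

/-- Minors are preserved by injective homomorphisms of the host graph. -/
theorem IsMinor.map_inj {W V V' : Type} {P : SimpleGraph W} {G : SimpleGraph V}
    {G' : SimpleGraph V'} (h : IsMinor P G) (φ : V → V') (hi : Function.Injective φ)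
    (hφ : ∀ x y, G.Adj x y → G'.Adj (φ x) (φ y)) : IsMinor P G' := by
  obtain ⟨f, hf⟩ := h
  refine ⟨_, IsModel.map (G' := G') hf φ (fun w w' x _ y _ h => Or.inr (hφ x y h)) ?_⟩
  intro w w' hne x hx y hy e
  exact hne (IsModel.eq_of_mem hf hx (hi e ▸ hy))

/-- Minors of `P` restrict along injective homomorphisms `P' → P`. -/
theorem IsMinor.comap_inj {W W' V : Type} {P : SimpleGraph W} {P' : SimpleGraph W'}
    {G : SimpleGraph V} (h : IsMinor P G) (ψ : W' → W) (hi : Function.Injective ψ)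
    (hψ : ∀ x y, P'.Adj x y → P.Adj (ψ x) (ψ y)) : IsMinor P' G := by
  obtain ⟨f, h1, h2, h3, h4⟩ := h
  exact ⟨fun w => f (ψ w), fun w => h1 _, fun w => h2 _, fun w w' hne => h3 (hi.ne hne),
    fun w w' h => h4 (hψ _ _ h)⟩

theorem IsModel.trans {W V U : Type} {A : SimpleGraph W} {P : SimpleGraph V}
    {G : SimpleGraph U} {g : W → Set V} {f : V → Set U} (hg : IsModel A P g)
    (hf : IsModel P G f) : IsModel A G (fun a => {x | ∃ b ∈ g a, x ∈ f b}) := by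
  refine ⟨?_, ?_, ?_, ?_⟩
  · intro a
    obtain ⟨b, hb⟩ := hg.1 a
    obtain ⟨x, hx⟩ := hf.1 b
    exact ⟨x, b, hb, hx⟩
  · intro a
    obtain ⟨b, hb⟩ := hg.1 a
    obtain ⟨x, hx⟩ := hf.1 b
    refine conn_of_root x ⟨b, hb, hx⟩ ?_
    have mono : ∀ b ∈ g a, ∀ p ∈ f b, ∀ q ∈ f b,
        Lnk G {x | ∃ b ∈ g a, x ∈ f b} p q := by
      intro b hb p hp q hq
      refine Relation.ReflTransGen.mono ?_ _ _ (((conn_iff G _).1 (hf.2.1 b)).2 p hp q hq)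
      exact fun u v h => ⟨h.1, ⟨b, hb, h.2.1⟩, ⟨b, hb, h.2.2⟩⟩
    rintro y ⟨b', hb', hy⟩
    have hl := ((conn_iff P _).1 (hg.2.1 a)).2 b hb b' hb'
    induction hl generalizing y with
    | refl => exact mono _ hb x hx y hy
    | tail _ h2 ih =>
      obtain ⟨p, hp, q, hq, hpq⟩ := hf.2.2.2 h2.1
      have h3 := ih p h2.2.1 hp
      exact (h3.tail ⟨hpq, ⟨_, h2.2.1, hp⟩, ⟨_, h2.2.2, hq⟩⟩).trans (mono _ hb' q hq y hy)
  · intro a a' hne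
    rw [Set.disjoint_left]
    rintro x ⟨b, hb, hx⟩ ⟨b', hb', hx'⟩
    have := hf.eq_of_mem hx hx'
    subst this
    exact hne (hg.eq_of_mem hb hb')
  · intro a a' haa
    obtain ⟨b, hb, b', hb', hbb⟩ := hg.2.2.2 haa
    obtain ⟨x, hx, y, hy, hxy⟩ := hf.2.2.2 hbb
    exact ⟨x, ⟨b, hb, hx⟩, y, ⟨b', hb', hy⟩, hxy⟩

/-- A model whose branch sets are stars. -/
theorem model_of_star {V : Type} {k : ℕ} (A : SimpleGraph (Fin k)) (G : SimpleGraph V)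
    (R : V → V → Prop) (hR : ∀ x y, R x y → G.Adj x y) (r : Fin k → V) (g : V → ℕ)
    (h1 : ∀ w, g (r w) = w) (h2 : ∀ x w, g x = (w : Fin k).1 → x = r w ∨ R (r w) x)
    (h3 : ∀ w w', A.Adj w w' → ∃ x y, g x = w.1 ∧ g y = w'.1 ∧ R x y) :
    IsModel A G (fun w => {x | g x = w.1}) := by
  refine ⟨fun w => ⟨r w, h1 w⟩, ?_, ?_, ?_⟩
  · intro w
    refine conn_of_root (r w) (h1 w) ?_
    intro y hy
    rcases h2 y w hy with e | e
    · rw [e]; exact Relation.ReflTransGen.refl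
    · exact Relation.ReflTransGen.single ⟨hR _ _ e, h1 w, hy⟩
  · intro w w' hne
    rw [Set.disjoint_left]
    intro x hx hx'
    exact hne (Fin.ext (hx.symm.trans hx'))
  · intro w w' h
    obtain ⟨x, y, hx, hy, hxy⟩ := h3 w w' h
    exact ⟨x, hx, y, hy, hR _ _ hxy⟩

theorem addEdge_adj {V : Type} (G : SimpleGraph V) (a b x y : V) :
    (addEdge G a b).Adj x y ↔ G.Adj x y ∨ (x ≠ y ∧ ((x = a ∧ y = b) ∨ (x = b ∧ y = a))) := by
  simp only [addEdge, SimpleGraph.sup_adj, SimpleGraph.fromEdgeSet_adj, Set.mem_singleton_iff,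
    Sym2.eq_iff]
  tauto

/-! ### Stacking a vertex -/

/-- Add a new vertex `none` adjacent to all elements of `S`. -/
def stack {V : Type} (G : SimpleGraph V) (S : Set V) : SimpleGraph (Option V) where
  Adj x y := match x, y with
    | none, none => False
    | none, some b => b ∈ S
    | some a, none => a ∈ S
    | some a, some b => G.Adj a b
  symm := ⟨by
    rintro (_ | x) (_ | y) h
    · exact h
    · exact h
    · exact h
    · exact SimpleGraph.Adj.symm h⟩
  loopless := ⟨by
    rintro (_ | x) h
    · exact h
    · exact G.loopless.irrefl x h⟩

theorem stack_cases {W V : Type} [Nonempty V] {P : SimpleGraph W} {G : SimpleGraph V}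
    {S : Set V} (hS : G.IsClique S) {f : W → Set (Option V)}
    (hf : IsModel P (stack G S) f) : IsMinor P G ∨ ∃ w, f w = {none} := by
  classical
  by_cases hA : ∃ w, none ∈ f w
  · obtain ⟨w, hw⟩ := hA
    by_cases hB : f w = {none}
    · exact Or.inr ⟨w, hB⟩
    left
    have : ∃ o ∈ f w, none ≠ o := by
      by_contra hcon
      push Not at hcon
      exact hB (Set.eq_singleton_iff_unique_mem.2 ⟨hw, fun x hx => (hcon x hx).symm⟩)
    obtain ⟨o, ho, hne⟩ := this
    obtain ⟨z, hz, hzadj⟩ := exists_nbr (hf.2.1 w) hw ho hne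
    obtain _ | u := z
    · exact absurd hzadj (by simp [stack])
    have hu : u ∈ S := hzadj
    refine ⟨_, hf.map (fun o => o.getD u) ?_ ?_⟩
    · rintro w1 w2 (_ | x) _ (_ | y) _ h
      · exact Or.inl rfl
      · by_cases e : u = y
        · exact Or.inl e
        · exact Or.inr (hS hu h e)
      · by_cases e : x = u
        · exact Or.inl e
        · exact Or.inr (hS h hu e)
      · exact Or.inr h
    · rintro w1 w2 hne (_ | x) hx (_ | y) hy h
      · exact hne (hf.eq_of_mem hx hy)
      · have e : u = y := h
        subst e
        exact hne ((hf.eq_of_mem hx hw).trans (hf.eq_of_mem hz hy))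
      · have e : x = u := h
        subst e
        exact hne ((hf.eq_of_mem hx hz).trans (hf.eq_of_mem hw hy))
      · have e : x = y := h
        subst e
        exact hne (hf.eq_of_mem hx hy)
  · left
    push Not at hA
    obtain ⟨d⟩ := ‹Nonempty V›
    refine ⟨_, hf.map (fun o => o.getD d) ?_ ?_⟩
    · rintro w1 w2 (_ | x) hx (_ | y) hy h
      · exact absurd hx (hA _)
      · exact absurd hx (hA _)
      · exact absurd hy (hA _)
      · exact Or.inr h
    · rintro w1 w2 hne (_ | x) hx (_ | y) hy h
      · exact absurd hx (hA _)
      · exact absurd hx (hA _)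
      · exact absurd hy (hA _)
      · have e : x = y := h
        subst e
        exact hne (hf.eq_of_mem hx hy)

/-- Pulling back a model that avoids the new vertex. -/
theorem model_unstack {W V : Type} [Nonempty V] {P : SimpleGraph W} {G : SimpleGraph V}
    {S : Set V} {f : W → Set (Option V)} (hf : IsModel P (stack G S) f)
    (hA : ∀ w, none ∉ f w) : IsMinor P G := by
  obtain ⟨d⟩ := ‹Nonempty V›
  refine ⟨_, hf.map (fun o => o.getD d) ?_ ?_⟩
  · rintro w1 w2 (_ | x) hx (_ | y) hy h
    · exact absurd hx (hA _)
    · exact absurd hx (hA _)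
    · exact absurd hy (hA _)
    · exact Or.inr h
  · rintro w1 w2 hne (_ | x) hx (_ | y) hy h
    · exact absurd hx (hA _)
    · exact absurd hx (hA _)
    · exact absurd hy (hA _)
    · have e : x = y := h
      subst e
      exact hne (hf.eq_of_mem hx hy)

/-- A clique of size at most four never helps to build a `K₆` minor. -/
theorem k6_stack {V : Type} [Nonempty V] {G : SimpleGraph V} {S : Finset V}
    (hS : G.IsClique (S : Set V)) (hc : S.card ≤ 4)
    (h : IsMinor (⊤ : SimpleGraph (Fin 6)) (stack G (S : Set V))) :
    IsMinor (⊤ : SimpleGraph (Fin 6)) G := by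
  classical
  obtain ⟨f, hf'⟩ := h
  have hf : IsModel _ _ f := hf'
  rcases stack_cases hS hf with h | ⟨w, hw⟩
  · exact h
  exfalso
  have hs : ∀ z, z ≠ w → ∃ s ∈ S, some s ∈ f z := by
    intro z hz
    obtain ⟨x, hx, y, hy, hxy⟩ := hf.2.2.2 (show (⊤ : SimpleGraph (Fin 6)).Adj w z from hz.symm)
    rw [hw] at hx
    have hx' : x = none := hx
    subst hx'
    obtain _ | y := y
    · exact absurd hxy (by simp [stack])
    · exact ⟨y, hxy, hy⟩
  choose! s hs1 hs2 using hs
  have h5 : (Finset.univ.erase w).card = 5 := by simp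
  have := Finset.card_le_card_of_injOn (s := Finset.univ.erase w) (t := S) s
    (fun z hz => hs1 z (Finset.ne_of_mem_erase hz)) (by
      intro z hz z' hz' e
      have e1 := hs2 z (Finset.ne_of_mem_erase hz)
      have e2 := hs2 z' (Finset.ne_of_mem_erase hz')
      rw [e] at e1
      exact hf.eq_of_mem e1 e2)
  omega

/-- Edges at the new vertex can be routed through it. -/
theorem stack_route {W V : Type} {P : SimpleGraph W} {G : SimpleGraph V} {S : Set V} {x s : V}
    (hs : s ∈ S) (h : IsMinor P (addEdge G x s)) :
    IsMinor P (addEdge (stack G S) none (some x)) := by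
  obtain ⟨f, hf'⟩ := h
  have hf : IsModel _ _ f := hf'
  have hns : (addEdge (stack G S) none (some x)).Adj none (some s) :=
    (addEdge_adj _ _ _ _ _).2 (Or.inl hs)
  have hnx : (addEdge (stack G S) none (some x)).Adj none (some x) :=
    (addEdge_adj _ _ _ _ _).2 (Or.inr ⟨by simp, Or.inl ⟨rfl, rfl⟩⟩)
  have hG : ∀ {p q}, G.Adj p q → (addEdge (stack G S) none (some x)).Adj (some p) (some q) :=
    fun h => (addEdge_adj _ _ _ _ _).2 (Or.inl h)
  refine ⟨fun w => {o | (∃ p ∈ f w, o = some p) ∨ (o = none ∧ x ∈ f w)}, ?_, ?_, ?_, ?_⟩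
  · intro w
    obtain ⟨p, hp⟩ := hf.1 w
    exact ⟨some p, Or.inl ⟨p, hp, rfl⟩⟩
  · intro w
    obtain ⟨⟨r, hr⟩, hl⟩ := (conn_iff _ _).1 (hf.2.1 w)
    have key : ∀ q ∈ f w, Lnk (addEdge (stack G S) none (some x))
        {o | (∃ p ∈ f w, o = some p) ∨ (o = none ∧ x ∈ f w)} (some r) (some q) := by
      intro q hq
      have h1 := hl r hr q hq
      induction h1 with
      | refl => exact Relation.ReflTransGen.refl
      | @tail b c _ h2 ih =>
        have ih' := ih h2.2.1
        have hb := h2.2.1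
        have hc := h2.2.2
        rcases (addEdge_adj _ _ _ _ _).1 h2.1 with h3 | ⟨_, ⟨e1, e2⟩ | ⟨e1, e2⟩⟩
        · exact ih'.tail ⟨hG h3, Or.inl ⟨_, hb, rfl⟩, Or.inl ⟨_, hc, rfl⟩⟩
        · subst e1 e2
          exact (ih'.tail ⟨hnx.symm, Or.inl ⟨_, hb, rfl⟩, Or.inr ⟨rfl, hb⟩⟩).tail
            ⟨hns, Or.inr ⟨rfl, hb⟩, Or.inl ⟨_, hc, rfl⟩⟩
        · subst e1 e2
          exact (ih'.tail ⟨hns.symm, Or.inl ⟨_, hb, rfl⟩, Or.inr ⟨rfl, hc⟩⟩).tail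
            ⟨hnx, Or.inr ⟨rfl, hc⟩, Or.inl ⟨_, hc, rfl⟩⟩
    refine conn_of_root (some r) (Or.inl ⟨r, hr, rfl⟩) ?_
    rintro o (⟨p, hp, rfl⟩ | ⟨rfl, hx⟩)
    · exact key p hp
    · exact (key x hx).tail ⟨hnx.symm, Or.inl ⟨_, hx, rfl⟩, Or.inr ⟨rfl, hx⟩⟩
  · intro w w' hne
    rw [Set.disjoint_left]
    rintro o (⟨p, hp, rfl⟩ | ⟨rfl, hx⟩) (⟨p', hp', e⟩ | ⟨e, hx'⟩)
    · cases e
      exact hne (hf.eq_of_mem hp hp')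
    · cases e
    · cases e
    · exact hne (hf.eq_of_mem hx hx')
  · intro w w' hww
    obtain ⟨p, hp, q, hq, hpq⟩ := hf.2.2.2 hww
    rcases (addEdge_adj _ _ _ _ _).1 hpq with h3 | ⟨_, ⟨e1, e2⟩ | ⟨e1, e2⟩⟩
    · exact ⟨some p, Or.inl ⟨p, hp, rfl⟩, some q, Or.inl ⟨q, hq, rfl⟩, hG h3⟩
    · subst e1 e2
      exact ⟨none, Or.inr ⟨rfl, hp⟩, some q, Or.inl ⟨q, hq, rfl⟩, hns⟩
    · subst e1 e2
      exact ⟨some p, Or.inl ⟨p, hp, rfl⟩, none, Or.inr ⟨rfl, hq⟩, hns.symm⟩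

theorem IsLinkless.not_iff {V : Type} {G : SimpleGraph V} :
    ¬ IsLinkless G ↔ ∃ (W : Type) (P : SimpleGraph W), IsPetersenFamily P ∧ IsMinor P G := by
  unfold IsLinkless
  push Not
  rfl

/-! ### Coded graphs -/

/-- The graph on `Fin (k + 1)` whose adjacency is read off from the bits of `c`. -/
def gr (k c : ℕ) : SimpleGraph (Fin (k + 1)) where
  Adj i j := i ≠ j ∧ (c.testBit (i.1 * (k + 1) + j.1) = true ∨
    c.testBit (j.1 * (k + 1) + i.1) = true)
  symm := ⟨fun _ _ h => ⟨h.1.symm, h.2.symm⟩⟩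
  loopless := ⟨fun _ h => h.1 rfl⟩

instance (k c : ℕ) : DecidableRel (gr k c).Adj := fun i j =>
  inferInstanceAs (Decidable (i ≠ j ∧ (c.testBit (i.1 * (k + 1) + j.1) = true ∨
    c.testBit (j.1 * (k + 1) + i.1) = true)))

/-- The `i`-th hexadecimal digit of `r`. -/
def dig (r i : ℕ) : ℕ := (r >>> (4 * i)) % 16

/-- The map coded by the hexadecimal digits of `r`. -/
def pm (k r i : ℕ) : Fin (k + 1) := Fin.ofNat (k + 1) (dig r i)

/-- The seven graphs of the Petersen family, as pairs (order minus one, adjacency bits). -/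
def fam : List (ℕ × ℕ) :=
  [(5, 549687102), (6, 8692579448), (7, 689887017184), (7, 141289399548024),
   (8, 9018245942255840), (6, 2224962149948), (9, 865395228826484960)]

/-- Isomorphisms for the triangle-to-star moves: (source, triangle mask, target, map). -/
def dTab : List (ℕ × ℕ × ℕ × ℕ) :=
  [(0, 7, 1, 106181136), (0, 11, 1, 106177296), (0, 19, 1, 106054416), (0, 35, 1, 103105296),
   (0, 13, 1, 106176816), (0, 21, 1, 106053936), (0, 37, 1, 103104816), (0, 25, 1, 106042416),
   (0, 41, 1, 103093296), (0, 49, 1, 102847536), (0, 14, 1, 106176771), (0, 22, 1, 106053891),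
   (0, 38, 1, 103104771), (0, 26, 1, 106042371), (0, 42, 1, 103093251), (0, 50, 1, 102847491),
   (0, 28, 1, 106041411), (0, 44, 1, 103092291), (0, 52, 1, 102846531), (0, 56, 1, 102827331),
   (1, 25, 2, 1985229328), (1, 41, 2, 1984246288), (1, 49, 2, 1984123408),
   (1, 26, 2, 1985229313), (1, 42, 2, 1984246273), (1, 50, 2, 1984123393),
   (1, 28, 2, 1985228833), (1, 44, 2, 1984245793), (1, 52, 2, 1984122913),
   (1, 56, 3, 1985229328), (2, 42, 4, 36344967696), (2, 50, 4, 36344906256),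
   (2, 44, 4, 36344967456), (2, 52, 4, 36344906016), (4, 52, 6, 654820258320),
   (5, 21, 2, 38090263), (5, 25, 2, 38101783), (5, 49, 2, 40190743), (5, 22, 2, 38090353),
   (5, 26, 2, 38101873), (5, 50, 2, 40190833), (5, 84, 2, 121976353), (5, 88, 2, 121987873),
   (5, 112, 2, 124076833)]

/-- Isomorphisms for the star-to-triangle moves: (source, vertex, target, inverse map). -/
def yTab : List (ℕ × ℕ × ℕ × ℕ) :=
  [(1, 6, 0, 5517840), (2, 0, 5, 124076833), (2, 6, 1, 122819632), (2, 7, 1, 106181136),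
   (3, 6, 1, 119604547), (3, 7, 1, 106181136), (4, 0, 2, 324421416), (4, 1, 2, 54941735),
   (4, 3, 2, 19355718), (4, 6, 2, 2267354115), (4, 7, 2, 2252681729), (4, 8, 2, 1985229328),
   (6, 0, 4, 17858729235), (6, 1, 4, 22137967619), (6, 2, 4, 21870576388),
   (6, 3, 4, 22658126337), (6, 4, 4, 22390735106), (6, 5, 4, 18095829010),
   (6, 6, 4, 40921813059), (6, 7, 4, 40907264033), (6, 8, 4, 40639873312),
   (6, 9, 4, 36344967696)]

/-- Kuratowski minors after deleting a vertex: (graph, vertex, which, roots, blocks). -/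
def kTab : List (ℕ × ℕ × ℕ × ℕ × ℕ) :=
  [(0, 0, 0, 344865, 4399375), (0, 1, 0, 344864, 4399600), (0, 2, 0, 344848, 4402960),
   (0, 3, 0, 344592, 4452880), (0, 4, 0, 340496, 5190160), (0, 5, 0, 274960, 16003600),
   (1, 0, 0, 344865, 4399375), (1, 1, 0, 344864, 4399600), (1, 2, 0, 344848, 4402960),
   (1, 3, 1, 6636048, 88338960), (1, 4, 1, 6631952, 89076240), (1, 5, 1, 6566416, 99889680),
   (1, 6, 1, 5517840, 257176080), (2, 0, 0, 344865, 541270287),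
   (2, 1, 1, 7676976, 1346507760), (2, 2, 1, 7672880, 1346510640),
   (2, 3, 1, 6636048, 88338960), (2, 4, 1, 6631952, 89076240), (2, 5, 1, 6566416, 99889680),
   (2, 6, 1, 5517840, 257176080), (2, 7, 1, 6566416, 4110692880),
   (3, 0, 1, 5519137, 542388495), (3, 1, 1, 5519136, 542388720),
   (3, 2, 1, 5519120, 542392080), (3, 3, 1, 6636048, 893645328),
   (3, 4, 1, 6631952, 894382608), (3, 5, 1, 6566416, 905196048),
   (3, 6, 1, 5517840, 1062482448), (3, 7, 1, 5517840, 4032049680),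
   (4, 0, 1, 8660273, 21745636111), (4, 1, 1, 7676976, 5641475056),
   (4, 2, 1, 7672880, 5641477936), (4, 3, 1, 6636048, 4383306256),
   (4, 4, 1, 6631952, 4384043536), (4, 5, 1, 6566416, 4394856976),
   (4, 6, 1, 5517840, 4552143376), (4, 7, 1, 6566416, 16995594768),
   (4, 8, 1, 6631952, 65317974544), (5, 0, 1, 5449281, 38880015),
   (5, 1, 1, 5449280, 38880240), (5, 2, 1, 5518864, 39075600), (5, 3, 1, 5514768, 39121680),
   (5, 4, 1, 5449232, 39797520), (5, 5, 1, 4400656, 49627920), (5, 6, 1, 5448720, 257049360),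
   (6, 0, 1, 8660273, 159184589583), (6, 1, 1, 7676976, 143080428528),
   (6, 2, 1, 7672880, 143080431408), (6, 3, 1, 6636048, 141822259728),
   (6, 4, 1, 6631952, 141822997008), (6, 5, 1, 6566416, 141833810448),
   (6, 6, 1, 5517840, 141991096848), (6, 7, 1, 6566416, 291873501712),
   (6, 8, 1, 6631952, 340195881488), (6, 9, 1, 6636048, 1048865612304)]

/-- Complete minors after adding an edge to the cone: (a, b, roots, blocks). -/
def mTab : List (ℕ × ℕ × ℕ × ℕ) :=
  [(0, 3, 9712144, 348499751440), (0, 4, 9712144, 352207516176),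
   (0, 5, 9712144, 352741241360), (0, 8, 9712144, 361602757136),
   (1, 3, 9712144, 361317544464), (1, 4, 9712144, 352242119184),
   (1, 5, 9712144, 352725512720), (1, 7, 9712144, 361585979920),
   (2, 3, 9712144, 360797450768), (2, 4, 9712144, 348432642576),
   (2, 5, 9712144, 348700029456), (2, 6, 9712144, 360831005200),
   (3, 8, 9712144, 348433691152), (4, 7, 9712144, 348432642576),
   (5, 6, 9777680, 348433625616)]

/-- Planar graphs of order 9. -/
def pl9 : List (ℕ) :=
  [2368114305482914695366]

/-- Planar graphs of order 8. -/
def pl8 : List (ℕ) :=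
  [36240730845921506, 36240867215856710]

/-- Planar graphs of order 7. -/
def pl7 : List (ℕ) :=
  [2224995835504, 2224996364402, 2224962809970]

/-- Planar graphs of order 6. -/
def pl6 : List (ℕ) :=
  [549619510, 549654328]

/-- Planar graphs of order 5. -/
def pl5 : List (ℕ) :=
  [549534]

/-- Contractions from order 9 to order 8. -/
def cTab9 : List (ℕ × ℕ × ℕ) :=
  [(2368114305482914695366, 36240730845921506, 31763669248),
   (2368114305482914695366, 36240730845921506, 31511027728),
   (2368114305482914695366, 36240730845921506, 31511027734),
   (2368114305482914695366, 36240730845921506, 31763669254),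
   (2368114305482914695366, 36240730845921506, 23457841153),
   (2368114305482914695366, 36240730845921506, 23457841249),
   (2368114305482914695366, 36240730845921506, 27737076064),
   (2368114305482914695366, 36240730845921506, 23205201409),
   (2368114305482914695366, 36240730845921506, 27231794704),
   (2368114305482914695366, 36240730845921506, 31760319538),
   (2368114305482914695366, 36240730845921506, 31507678018),
   (2368114305482914695366, 36240730845921506, 31507702594),
   (2368114305482914695366, 36240730845921506, 31760344114),
   (2368114305482914695366, 36240730845921506, 23454552868),
   (2368114305482914695366, 36240730845921506, 23454946084),
   (2368114305482914695366, 36240730845921506, 27734180899),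
   (2368114305482914695366, 36240730845921506, 23209185844),
   (2368114305482914695366, 36240730845921506, 27235779139),
   (2368114305482914695366, 36240867215856710, 31781564944),
   (2368114305482914695366, 36240867215856710, 27754971649),
   (2368114305482914695366, 36240867215856710, 27501346849)]

/-- Contractions from order 8 to order 7. -/
def cTab8 : List (ℕ × ℕ × ℕ) :=
  [(36240730845921506, 2224995835504, 1698898176),
   (36240730845921506, 2224995835504, 1698898180),
   (36240730845921506, 2224995835504, 1415655940),
   (36240730845921506, 2224995835504, 1163993860),
   (36240730845921506, 2224995835504, 1683108160),
   (36240730845921506, 2224995835504, 1179784000),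
   (36240730845921506, 2224996364402, 1698898448),
   (36240730845921506, 2224962809970, 1698837008),
   (36240730845921506, 2224962809970, 1698837520),
   (36240730845921506, 2224996364402, 1698899216),
   (36240730845921506, 2224962809970, 1447174928),
   (36240730845921506, 2224962809970, 1447183120),
   (36240730845921506, 2224996364402, 1447252496),
   (36240730845921506, 2224962809970, 1447437072),
   (36240730845921506, 2224962809970, 1699099152),
   (36240730845921506, 2224962809970, 1181024562),
   (36240730845921506, 2224962809970, 1684344882),
   (36240730845921506, 2224996364402, 1430347826),
   (36240867215856710, 2224962809970, 1445212416),
   (36240867215856710, 2224962809970, 1445212417),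
   (36240867215856710, 2224962809970, 1445212422),
   (36240867215856710, 2224996364402, 1160130561),
   (36240867215856710, 2224996364402, 1176842321),
   (36240867215856710, 2224996364402, 1163924051),
   (36240867215856710, 2224962809970, 1179652930),
   (36240867215856710, 2224996364402, 1160131841),
   (36240867215856710, 2224962809970, 1174737955),
   (36240867215856710, 2224962809970, 1443889731),
   (36240867215856710, 2224962809970, 1443893827),
   (36240867215856710, 2224962809970, 1443914307),
   (36240867215856710, 2224996364402, 1159868513),
   (36240867215856710, 2224996364402, 1160066561),
   (36240867215856710, 2224962809970, 1177822465),
   (36240867215856710, 2224996364402, 1163014241),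
   (36240867215856710, 2224962809970, 1448088131),
   (36240867215856710, 2224962809970, 1714693377)]

/-- Contractions from order 7 to order 6. -/
def cTab7 : List (ℕ × ℕ × ℕ) :=
  [(2224995835504, 549619510, 88093200), (2224995835504, 549619510, 84157200),
   (2224995835504, 549619510, 5513520), (2224995835504, 549654328, 88285456),
   (2224995835504, 549654328, 87298576), (2224995835504, 549654328, 87298624),
   (2224995835504, 549654328, 88285504), (2224995835504, 549654328, 55841056),
   (2224995835504, 549654328, 55841824), (2224995835504, 549654328, 72557584),
   (2224995835504, 549654328, 54870304), (2224995835504, 549654328, 70599184),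
   (2224995835504, 549654328, 54808864), (2224995835504, 549654328, 70537744),
   (2224995835504, 549654328, 71509264), (2224996364402, 549654328, 88285440),
   (2224996364402, 549654328, 88146721), (2224996364402, 549654328, 88285444),
   (2224996364402, 549654328, 72556804), (2224996364402, 549654328, 88285504),
   (2224996364402, 549654328, 72556864), (2224996364402, 549654328, 88277025),
   (2224996364402, 549654328, 88277793), (2224996364402, 549654328, 88278049),
   (2224996364402, 549654328, 72549409), (2224996364402, 549654328, 88293409),
   (2224996364402, 549654328, 72564769), (2224996364402, 549654328, 88351024),
   (2224996364402, 549654328, 72622384), (2224996364402, 549654328, 71508304),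
   (2224962809970, 549654328, 87302400), (2224962809970, 549654328, 87302404),
   (2224962809970, 549654328, 68485921), (2224962809970, 549654328, 70590724),
   (2224962809970, 549654328, 85197586), (2224962809970, 549654328, 70590784),
   (2224962809970, 549654328, 88277025), (2224962809970, 549654328, 72549153),
   (2224962809970, 549654328, 88278049), (2224962809970, 549654328, 72549409),
   (2224962809970, 549654328, 88289313), (2224962809970, 549654328, 72564769),
   (2224962809970, 549654328, 88351024), (2224962809970, 549654328, 68420434),
   (2224962809970, 549654328, 71389699)]

/-- Contractions from order 6 to order 5. -/
def cTab6 : List (ℕ × ℕ × ℕ) :=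
  [(549619510, 549534, 4399360), (549619510, 549534, 3416080), (549619510, 549534, 3162640),
   (549619510, 549534, 213280), (549619510, 549534, 4337665), (549619510, 549534, 4399392),
   (549619510, 549534, 4207105), (549619510, 549534, 3416592), (549619510, 549534, 2372097),
   (549619510, 549534, 3424784), (549619510, 549534, 4407584), (549619510, 549534, 4469249),
   (549654328, 549534, 4330241), (549654328, 549534, 4206880), (549654328, 549534, 274720),
   (549654328, 549534, 4326193), (549654328, 549534, 4326145), (549654328, 549534, 2114305),
   (549654328, 549534, 148225), (549654328, 549534, 4202545), (549654328, 549534, 270385),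
   (549654328, 549534, 2098195), (549654328, 549534, 132115), (549654328, 549534, 9235)]

/-- Order (minus one) of the `i`-th graph of the family. -/
def fk (i : ℕ) : ℕ := (fam.getD i (5, 0)).1

/-- Code of the `i`-th graph of the family. -/
def fc (i : ℕ) : ℕ := (fam.getD i (5, 0)).2

/-- The `i`-th graph of the family. -/
def pet (i : ℕ) : SimpleGraph (Fin (fk i + 1)) := gr (fk i) (fc i)

instance (i : ℕ) : DecidableRel (pet i).Adj := inferInstanceAs (DecidableRel (gr _ _).Adj)

/-- Neighbourhoods in the coded graphs. -/
def nb (i : ℕ) (w : Fin (fk i + 1)) : Finset (Fin (fk i + 1)) :=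
  Finset.univ.filter (fun z => (pet i).Adj w z)

theorem fact_deg : ∀ i : Fin 7, ∀ w, 3 ≤ (nb i w).card := by decide +kernel

theorem fact_four : ∀ i : Fin 7, ∀ w, (nb i w).card = 4 → ∀ w', (pet i).Adj w w' →
    2 ≤ (Finset.univ.filter (fun z => (pet i).Adj w' z ∧ z ≠ w ∧ ¬ (pet i).Adj w z)).card := by
  decide +kernel

/-- The table entry codes an isomorphism from the result of a triangle-to-star move. -/
abbrev OkD (i : ℕ) (a b c : Fin (fk i + 1)) (j p : ℕ) : Prop :=
  fk j = fk i + 1 ∧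
  (∀ x y : Fin (fk i + 1), ((pet i).Adj x y ∧ ¬ ((x = a ∨ x = b ∨ x = c) ∧ (y = a ∨ y = b ∨ y = c)))
    ↔ (pet j).Adj (pm (fk j) p x) (pm (fk j) p y)) ∧
  (∀ x : Fin (fk i + 1), (x = a ∨ x = b ∨ x = c) ↔
    (pet j).Adj (pm (fk j) p (fk i + 1)) (pm (fk j) p x)) ∧
  (∀ x y : Fin (fk i + 1), pm (fk j) p x = pm (fk j) p y → x = y) ∧
  (∀ x : Fin (fk i + 1), pm (fk j) p (fk i + 1) ≠ pm (fk j) p x)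

theorem fact_D : ∀ i : Fin 7, ∀ a b c : Fin (fk i + 1), (pet i).Adj a b → (pet i).Adj b c →
    (pet i).Adj a c → ∃ t ∈ dTab, t.1 = i.1 ∧ t.2.1 = 2 ^ a.1 + 2 ^ b.1 + 2 ^ c.1 ∧
      t.2.2.1 < 7 ∧ OkD i a b c t.2.2.1 t.2.2.2 := by
  decide +kernel

/-- The table entry codes an isomorphism onto the result of a star-to-triangle move. -/
abbrev OkY (i : ℕ) (u : Fin (fk i + 1)) (j r : ℕ) : Prop :=
  (∀ x y : Fin (fk j + 1), (pet j).Adj x y ↔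
    ((pet i).Adj (pm (fk i) r x) (pm (fk i) r y) ∨
      (x ≠ y ∧ (pet i).Adj u (pm (fk i) r x) ∧ (pet i).Adj u (pm (fk i) r y)))) ∧
  (∀ x y : Fin (fk j + 1), pm (fk i) r x = pm (fk i) r y → x = y) ∧
  (∀ x : Fin (fk j + 1), pm (fk i) r x ≠ u) ∧
  (∀ z : Fin (fk i + 1), z ≠ u → ∃ x : Fin (fk j + 1), pm (fk i) r x = z)

theorem fact_Y : ∀ i : Fin 7, ∀ u : Fin (fk i + 1), (nb i u).card = 3 →
    ∃ t ∈ yTab, t.1 = i.1 ∧ t.2.1 = u.1 ∧ t.2.2.1 < 7 ∧ OkY i u t.2.2.1 t.2.2.2 := by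
  decide +kernel

/-- The two Kuratowski graphs. -/
def kur (j : ℕ) : ℕ × ℕ := if j = 0 then (4, 549790) else (5, 233016)

/-- The table entry codes a star model avoiding the vertex `w`. -/
abbrev OkK (i : ℕ) (w : Fin (fk i + 1)) (j r g : ℕ) : Prop :=
  dig g w ≥ 10 ∧
  (∀ a : Fin ((kur j).1 + 1), dig g (pm (fk i) r a) = a) ∧
  (∀ (x : Fin (fk i + 1)) (a : Fin ((kur j).1 + 1)), dig g x = a →
    x = pm (fk i) r a ∨ (pet i).Adj (pm (fk i) r a) x) ∧
  (∀ a b : Fin ((kur j).1 + 1), (gr (kur j).1 (kur j).2).Adj a b →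
    ∃ x y : Fin (fk i + 1), dig g x = a ∧ dig g y = b ∧ (pet i).Adj x y)

theorem fact_K : ∀ i : Fin 7, ∀ w : Fin (fk i + 1),
    ∃ t ∈ kTab, t.1 = i.1 ∧ t.2.1 = w.1 ∧ t.2.2.1 < 2 ∧ OkK i w t.2.2.1 t.2.2.2.1 t.2.2.2.2 := by
  decide +kernel

/-- The contraction tables send the graphs in `L` to those in `L'`. -/
abbrev OkC (k : ℕ) (L L' : List ℕ) (tab : List (ℕ × ℕ × ℕ)) : Prop :=
  ∀ c ∈ L, (∀ u : Fin (k + 2), ∃ v, (gr (k + 1) c).Adj u v) ∧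
    ∀ u v : Fin (k + 2), u < v → (gr (k + 1) c).Adj u v → ∃ t ∈ tab, t.1 = c ∧
      pm k t.2.2 u = pm k t.2.2 v ∧ t.2.1 ∈ L' ∧
      (∀ x y : Fin (k + 2), (gr (k + 1) c).Adj x y →
        pm k t.2.2 x = pm k t.2.2 y ∨ (gr k t.2.1).Adj (pm k t.2.2 x) (pm k t.2.2 y)) ∧
      (∀ x y : Fin (k + 2), pm k t.2.2 x = pm k t.2.2 y →
        x = y ∨ (x = u ∧ y = v) ∨ (x = v ∧ y = u))

theorem fact_C9 : OkC 7 pl9 pl8 cTab9 := by decide +kernel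
theorem fact_C8 : OkC 6 pl8 pl7 cTab8 := by decide +kernel
theorem fact_C7 : OkC 5 pl7 pl6 cTab7 := by decide +kernel
theorem fact_C6 : OkC 4 pl6 pl5 cTab6 := by decide +kernel

theorem fact_P5 : ∀ c ∈ pl5, ∃ x y : Fin 5, x ≠ y ∧ ¬ (gr 4 c).Adj x y := by decide +kernel

theorem fact_P6 : ∀ c ∈ pl6, ∀ x y z : Fin 6, x ≠ y → x ≠ z → y ≠ z → ∀ a,
    (gr 5 c).Adj x a → (gr 5 c).Adj y a → (gr 5 c).Adj z a → ∀ b,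
    (gr 5 c).Adj x b → (gr 5 c).Adj y b → (gr 5 c).Adj z b → a ≠ b → ∀ d,
    (gr 5 c).Adj x d → (gr 5 c).Adj y d → (gr 5 c).Adj z d → d = a ∨ d = b := by
  decide +kernel
theorem fact_K5 : ∀ x y : Fin 5, x ≠ y → (gr 4 549790).Adj x y := by decide +kernel
theorem fact_K33 : ∀ x : Fin 3, ∀ y : Fin 3, (gr 5 233016).Adj ⟨x.1, by omega⟩ ⟨y.1 + 3, by omega⟩ := by
  decide +kernel
theorem fact_0 : ∀ x y : Fin 6, x ≠ y → (gr 5 549687102).Adj x y := by decide +kernel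

/-- The planar triangulation obtained by gluing two octahedra along a face. -/
def tri : SimpleGraph (Fin 9) := gr 8 2368114305482914695366

instance : DecidableRel tri.Adj := inferInstanceAs (DecidableRel (gr _ _).Adj)

/-- Adjacency of the cone over `tri` with an edge added. -/
abbrev RM (a b : Fin 9) (x y : Option (Fin 9)) : Prop :=
  match x, y with
    | none, none => False
    | none, some _ => True
    | some _, none => True
    | some x, some y => tri.Adj x y ∨ (x = a ∧ y = b) ∨ (x = b ∧ y = a)

instance (a b : Fin 9) : DecidableRel (RM a b) := fun x y =>
  match x, y with
    | none, none => inferInstanceAs (Decidable False)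
    | none, some _ => inferInstanceAs (Decidable True)
    | some _, none => inferInstanceAs (Decidable True)
    | some x, some y => inferInstanceAs
      (Decidable (tri.Adj x y ∨ (x = a ∧ y = b) ∨ (x = b ∧ y = a)))

/-- Decoding of vertices of the cone. -/
def op (i : ℕ) : Option (Fin 9) := if h : i < 9 then some ⟨i, h⟩ else none

/-- Coding of vertices of the cone. -/
def po (x : Option (Fin 9)) : ℕ := match x with
  | none => 9
  | some i => i.1

theorem fact_M : ∀ a b : Fin 9, a < b → ¬ tri.Adj a b →
    ∃ t ∈ mTab, t.1 = a.1 ∧ t.2.1 = b.1 ∧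
      (∀ w : Fin 6, dig t.2.2.2 (po (op (dig t.2.2.1 w))) = w) ∧
      (∀ (x : Option (Fin 9)) (w : Fin 6), dig t.2.2.2 (po x) = w →
        x = op (dig t.2.2.1 w) ∨ RM a b (op (dig t.2.2.1 w)) x) ∧
      (∀ w w' : Fin 6, w ≠ w' →
        ∃ x y, dig t.2.2.2 (po x) = w ∧ dig t.2.2.2 (po y) = w' ∧ RM a b x y) := by
  decide +kernel

/-! ### Classification of the Petersen family -/

theorem triangleY_some {V : Type} (G : SimpleGraph V) (a b c x y : V) :
    (triangleY G a b c).Adj (some x) (some y) ↔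
      G.Adj x y ∧ ¬ ((x = a ∨ x = b ∨ x = c) ∧ (y = a ∨ y = b ∨ y = c)) := by
  have h1 : (triangleY G a b c).Adj (some x) (some y) ↔ G.Adj x y ∧
      ¬ (s(x, y) = s(a, b) ∨ s(x, y) = s(b, c) ∨ s(x, y) = s(a, c)) := by
    rw [triangleY, SimpleGraph.sup_adj, SimpleGraph.map_adj]
    simp
  rw [h1]
  simp only [Sym2.eq_iff]
  constructor
  · rintro ⟨h, h2⟩
    refine ⟨h, ?_⟩
    have := h.ne
    rintro ⟨rfl | rfl | rfl, rfl | rfl | rfl⟩ <;> simp_all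
  · rintro ⟨h, h2⟩
    refine ⟨h, ?_⟩
    tauto

theorem triangleY_none {V : Type} (G : SimpleGraph V) (a b c x : V) :
    (triangleY G a b c).Adj none (some x) ↔ (x = a ∨ x = b ∨ x = c) := by
  rw [triangleY, SimpleGraph.sup_adj, SimpleGraph.map_adj]
  simp

theorem pet_D (i : ℕ) (a b c : Fin (fk i + 1)) (j p : ℕ) (h : OkD i a b c j p) :
    Nonempty (triangleY (pet i) a b c ≃g pet j) := by
  obtain ⟨h0, h1, h2, h3, h4⟩ := h
  let F : Option (Fin (fk i + 1)) → Fin (fk j + 1) := fun o => match o with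
    | none => pm (fk j) p (fk i + 1)
    | some x => pm (fk j) p x
  have hF : Function.Bijective F := by
    rw [Fintype.bijective_iff_injective_and_card]
    constructor
    · rintro (_ | x) (_ | y) e
      · rfl
      · exact absurd e (h4 y)
      · exact absurd e.symm (h4 x)
      · exact congrArg some (h3 x y e)
    · simp [h0]
  refine ⟨⟨Equiv.ofBijective F hF, ?_⟩⟩
  rintro (_ | x) (_ | y)
  · exact ⟨fun h => absurd rfl h.ne, fun h => absurd rfl h.ne⟩
  · exact (h2 y).symm.trans (triangleY_none _ _ _ _ _).symm
  · rw [SimpleGraph.adj_comm, SimpleGraph.adj_comm (triangleY _ _ _ _)]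
    exact (h2 x).symm.trans (triangleY_none _ _ _ _ _).symm
  · exact (h1 x y).symm.trans (triangleY_some _ _ _ _ _ _).symm

/-- Isomorphic graphs stay isomorphic after corresponding triangle-to-star moves. -/
theorem triangleY_congr {V W : Type} {G : SimpleGraph V} {H : SimpleGraph W} (e : G ≃g H)
    (a b c : V) : Nonempty (triangleY G a b c ≃g triangleY H (e a) (e b) (e c)) := by
  have hadj : ∀ x y, H.Adj (e x) (e y) ↔ G.Adj x y := fun x y => e.map_adj_iff
  refine ⟨⟨Equiv.optionCongr e.toEquiv, ?_⟩⟩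
  rintro (_ | x) (_ | y)
  · exact ⟨fun h => absurd rfl h.ne, fun h => absurd rfl h.ne⟩
  · change (triangleY H (e a) (e b) (e c)).Adj none (some (e y)) ↔ _
    rw [triangleY_none, triangleY_none]
    simp
  · change (triangleY H (e a) (e b) (e c)).Adj (some (e x)) none ↔ _
    rw [SimpleGraph.adj_comm, SimpleGraph.adj_comm (triangleY G _ _ _), triangleY_none,
      triangleY_none]
    simp
  · change (triangleY H (e a) (e b) (e c)).Adj (some (e x)) (some (e y)) ↔ _
    rw [triangleY_some, triangleY_some, hadj]
    simp

theorem pet_Y {V : Type} {G : SimpleGraph V} {a b c : V} (hab : G.Adj a b) (hbc : G.Adj b c)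
    (hac : G.Adj a c) (i : Fin 7) (e : triangleY G a b c ≃g pet i) :
    ∃ j : Fin 7, Nonempty (G ≃g pet j) := by
  classical
  have hadj : ∀ x y, (pet i).Adj (e x) (e y) ↔ (triangleY G a b c).Adj x y :=
    fun x y => e.map_adj_iff
  have hnb : nb i (e none) = {e (some a), e (some b), e (some c)} := by
    ext z
    obtain ⟨o, rfl⟩ := e.surjective z
    simp only [nb, Finset.mem_filter, Finset.mem_univ, true_and, hadj, Finset.mem_insert,
      Finset.mem_singleton, EmbeddingLike.apply_eq_iff_eq]
    obtain _ | x := o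
    · simp
    · rw [triangleY_none]; simp
  have hcard : (nb i (e none)).card = 3 := by
    rw [hnb, Finset.card_eq_three]
    refine ⟨_, _, _, ?_, ?_, ?_, rfl⟩
    · simpa using hab.ne
    · simpa using hac.ne
    · simpa using hbc.ne
  obtain ⟨t, _, _, _, hj, h1, h2, h3, h4⟩ := fact_Y i (e none) hcard
  refine ⟨⟨t.2.2.1, hj⟩, ?_⟩
  have hex : ∀ x : Fin (fk t.2.2.1 + 1), ∃ v : V, e (some v) = pm (fk i) t.2.2.2 x := by
    intro x
    obtain ⟨o, ho⟩ := e.surjective (pm (fk i) t.2.2.2 x)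
    obtain _ | v := o
    · exact absurd ho.symm (h3 x)
    · exact ⟨v, ho⟩
  choose F hF using hex
  have hbij : Function.Bijective F := by
    constructor
    · intro x y exy
      apply h2
      rw [← hF, ← hF, exy]
    · intro v
      obtain ⟨x, hx⟩ := h4 (e (some v)) (by simp)
      refine ⟨x, ?_⟩
      have := (hF x).trans hx
      simpa using this
  refine ⟨SimpleGraph.Iso.symm ⟨Equiv.ofBijective F hbij, ?_⟩⟩
  intro x y
  change G.Adj (F x) (F y) ↔ (pet t.2.2.1).Adj x y
  have hne : x ≠ y ↔ F x ≠ F y := hbij.1.ne_iff.symm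
  rw [h1, ← hF, ← hF, hadj, hadj, hadj, triangleY_some, triangleY_none, triangleY_none, hne]
  constructor
  · intro h
    by_cases hh : (F x = a ∨ F x = b ∨ F x = c) ∧ (F y = a ∨ F y = b ∨ F y = c)
    · exact Or.inr ⟨h.ne, hh⟩
    · exact Or.inl ⟨h, hh⟩
  · rintro (h | ⟨h, h5, h6⟩)
    · exact h.1
    · rcases h5 with h5 | h5 | h5 <;> rcases h6 with h6 | h6 | h6 <;> rw [h5, h6] at h ⊢
      · exact absurd rfl h
      · exact hab
      · exact hac
      · exact hab.symm
      · exact absurd rfl h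
      · exact hbc
      · exact hac.symm
      · exact hbc.symm
      · exact absurd rfl h

theorem classify {V : Type} {P : SimpleGraph V} (h : IsPetersenFamily P) :
    ∃ i : Fin 7, Nonempty (P ≃g pet i) := by
  induction h with
  | k6 =>
    refine ⟨0, ⟨⟨Equiv.refl (Fin 6), ?_⟩⟩⟩
    intro x y
    exact ⟨fun h => h.ne, fun h => fact_0 x y h⟩
  | deltaY _ hab hbc hac ih =>
    obtain ⟨i, ⟨e⟩⟩ := ih
    obtain ⟨t, _, _, _, hj, hok⟩ := fact_D i _ _ _ (e.map_adj_iff.2 hab) (e.map_adj_iff.2 hbc)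
      (e.map_adj_iff.2 hac)
    obtain ⟨e1⟩ := triangleY_congr e _ _ _
    obtain ⟨e2⟩ := pet_D _ _ _ _ _ _ hok
    exact ⟨⟨_, hj⟩, ⟨e1.trans e2⟩⟩
  | yDelta _ hab hbc hac ih =>
    obtain ⟨i, ⟨e⟩⟩ := ih
    exact pet_Y hab hbc hac i e
  | iso _ e ih =>
    obtain ⟨i, ⟨e'⟩⟩ := ih
    exact ⟨i, ⟨e.symm.trans e'⟩⟩

theorem pet_step_up {i : ℕ} (hi : IsPetersenFamily (pet i)) (A B C j p : ℕ)
    (h : (pet i).Adj (Fin.ofNat _ A) (Fin.ofNat _ B) ∧ (pet i).Adj (Fin.ofNat _ B) (Fin.ofNat _ C) ∧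
      (pet i).Adj (Fin.ofNat _ A) (Fin.ofNat _ C) ∧
      OkD i (Fin.ofNat _ A) (Fin.ofNat _ B) (Fin.ofNat _ C) j p) :
    IsPetersenFamily (pet j) := by
  obtain ⟨h1, h2, h3, h4⟩ := h
  obtain ⟨e⟩ := pet_D _ _ _ _ _ _ h4
  exact .iso (.deltaY hi h1 h2 h3) e

theorem pet_step_down {i : ℕ} (A B C j p : ℕ)
    (hj : IsPetersenFamily (pet j))
    (h : (pet i).Adj (Fin.ofNat _ A) (Fin.ofNat _ B) ∧ (pet i).Adj (Fin.ofNat _ B) (Fin.ofNat _ C) ∧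
      (pet i).Adj (Fin.ofNat _ A) (Fin.ofNat _ C) ∧
      OkD i (Fin.ofNat _ A) (Fin.ofNat _ B) (Fin.ofNat _ C) j p) :
    IsPetersenFamily (pet i) := by
  obtain ⟨h1, h2, h3, h4⟩ := h
  obtain ⟨e⟩ := pet_D _ _ _ _ _ _ h4
  exact .yDelta (.iso hj e.symm) h1 h2 h3

theorem pet_mem (i : Fin 7) : IsPetersenFamily (pet i) := by
  have h0 : IsPetersenFamily (pet 0) := by
    refine .iso .k6 (H := pet 0) ⟨Equiv.refl (Fin 6), ?_⟩
    intro x y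
    exact ⟨fun h => h.ne, fun h => fact_0 x y h⟩
  have h1 : IsPetersenFamily (pet 1) :=
    pet_step_up h0 0 1 2 1 106181136 (by decide +kernel)
  have h2 : IsPetersenFamily (pet 2) :=
    pet_step_up h1 0 3 4 2 1985229328 (by decide +kernel)
  have h3 : IsPetersenFamily (pet 3) :=
    pet_step_up h1 3 4 5 3 1985229328 (by decide +kernel)
  have h4 : IsPetersenFamily (pet 4) :=
    pet_step_up h2 1 3 5 4 36344967696 (by decide +kernel)
  have h5 : IsPetersenFamily (pet 5) :=
    pet_step_down 0 2 4 2 38090263 h2 (by decide +kernel)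
  have h6 : IsPetersenFamily (pet 6) :=
    pet_step_up h4 2 4 5 6 654820258320 (by decide +kernel)
  obtain ⟨i, hi⟩ := i
  interval_cases i
  · exact h0
  · exact h1
  · exact h2
  · exact h3
  · exact h4
  · exact h5
  · exact h6

theorem linkless_iff {V : Type} {G : SimpleGraph V} :
    IsLinkless G ↔ ∀ i : Fin 7, ¬ IsMinor (pet i) G := by
  constructor
  · intro h i
    exact h _ (pet_mem i)
  · intro h W P hP hm
    obtain ⟨i, ⟨e⟩⟩ := classify hP
    refine h i (hm.comap_inj e.symm e.symm.injective ?_)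
    exact fun x y hxy => e.symm.map_adj_iff.2 hxy

/-! ### The triangulation has no Kuratowski minor -/

theorem chain {W : Type} [Fintype W] {P : SimpleGraph W} {k : ℕ} {L L' : List ℕ}
    {tab : List (ℕ × ℕ × ℕ)} (hok : OkC k L L' tab) (hcard : Fintype.card W ≤ k + 1)
    (h : ∃ c ∈ L, IsMinor P (gr (k + 1) c)) : ∃ c ∈ L', IsMinor P (gr k c) := by
  obtain ⟨c, hc, f, hf'⟩ := h
  have hf : IsModel _ _ f := hf'
  obtain ⟨hnb, hcon⟩ := hok c hc
  have key : ∃ u v, (gr (k + 1) c).Adj u v ∧ ∀ w w', u ∈ f w → v ∈ f w' → w = w' := by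
    by_cases hA : ∃ u, ∀ w, u ∉ f w
    · obtain ⟨u, hu⟩ := hA
      obtain ⟨v, hv⟩ := hnb u
      exact ⟨u, v, hv, fun w w' h => absurd h (hu w)⟩
    · push Not at hA
      choose g hg using hA
      obtain ⟨u, v, huv, e⟩ := Fintype.exists_ne_map_eq_of_card_lt g (by simp; omega)
      obtain ⟨z, hz, hadj⟩ := exists_nbr (hf.2.1 (g u)) (hg u) (e ▸ hg v) huv
      refine ⟨u, z, hadj, fun w w' h h' => ?_⟩
      rw [hf.eq_of_mem h (hg u), hf.eq_of_mem h' hz]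
  have key2 : ∃ u v, u < v ∧ (gr (k + 1) c).Adj u v ∧ ∀ w w', u ∈ f w → v ∈ f w' → w = w' := by
    obtain ⟨u, v, huv, h⟩ := key
    rcases lt_or_gt_of_ne huv.ne with hl | hl
    · exact ⟨u, v, hl, huv, h⟩
    · exact ⟨v, u, hl, huv.symm, fun w w' h1 h2 => (h w' w h2 h1).symm⟩
  obtain ⟨u, v, hl, huv, hsame⟩ := key2
  obtain ⟨t, _, _, _, htL, hhom, hinj⟩ := hcon u v hl huv
  refine ⟨_, htL, _, hf.map (fun x => pm k t.2.2 x) (fun w w' x _ y _ h => hhom x y h) ?_⟩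
  intro w w' hne x hx y hy e
  rcases hinj x y e with rfl | ⟨rfl, rfl⟩ | ⟨rfl, rfl⟩
  · exact hne (hf.eq_of_mem hx hy)
  · exact hne (hsame _ _ hx hy)
  · exact hne (hsame _ _ hy hx).symm

theorem minor_same_card {W V : Type} [Fintype W] [Fintype V] {P : SimpleGraph W}
    {G : SimpleGraph V} (hcard : Fintype.card W = Fintype.card V) (h : IsMinor P G) :
    ∃ φ : W → V, Function.Bijective φ ∧ ∀ x y, P.Adj x y → G.Adj (φ x) (φ y) := by
  obtain ⟨f, hf'⟩ := h
  have hf : IsModel _ _ f := hf'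
  choose φ hφ using hf.1
  have hinj : Function.Injective φ := fun x y e => hf.eq_of_mem (hφ x) (e ▸ hφ y)
  have hb : Function.Bijective φ := (Fintype.bijective_iff_injective_and_card φ).2 ⟨hinj, hcard⟩
  have hs : ∀ w, ∀ x ∈ f w, x = φ w := by
    intro w x hx
    obtain ⟨w', rfl⟩ := hb.2 x
    rw [hf.eq_of_mem hx (hφ w')]
  refine ⟨φ, hb, fun x y h => ?_⟩
  obtain ⟨a, ha, b, hb', hab⟩ := hf.2.2.2 h
  rw [hs _ _ ha, hs _ _ hb'] at hab
  exact hab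

theorem tri_start {W : Type} {P : SimpleGraph W} (h : IsMinor P tri) :
    ∃ c ∈ pl9, IsMinor P (gr (7 + 1) c) := ⟨_, List.mem_singleton.2 rfl, h⟩

theorem tri_K5 : ¬ IsMinor (gr 4 549790) tri := by
  intro h
  obtain ⟨c, hc, hm⟩ := chain (k := 4) fact_C6 (by simp) (chain (k := 5) fact_C7 (by simp)
    (chain (k := 6) fact_C8 (by simp) (chain (k := 7) fact_C9 (by simp) (tri_start h))))
  obtain ⟨φ, hb, hφ⟩ := minor_same_card rfl hm
  obtain ⟨x, y, hxy, hn⟩ := fact_P5 c hc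
  obtain ⟨x, rfl⟩ := hb.2 x
  obtain ⟨y, rfl⟩ := hb.2 y
  exact hn (hφ _ _ (fact_K5 _ _ (fun e => hxy (e ▸ rfl))))

theorem tri_K33 : ¬ IsMinor (gr 5 233016) tri := by
  intro h
  obtain ⟨c, hc, hm⟩ := chain (k := 5) fact_C7 (by simp)
    (chain (k := 6) fact_C8 (by simp) (chain (k := 7) fact_C9 (by simp) (tri_start h)))
  obtain ⟨φ, hb, hφ⟩ := minor_same_card rfl hm
  have hK : ∀ x y : Fin 3, (gr 5 c).Adj (φ ⟨x.1, by omega⟩) (φ ⟨y.1 + 3, by omega⟩) :=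
    fun x y => hφ _ _ (fact_K33 x y)
  have hne : ∀ x y : Fin 6, x ≠ y → φ x ≠ φ y := fun x y h => hb.1.ne h
  have := fact_P6 c hc (φ 0) (φ 1) (φ 2) (hne _ _ (by decide)) (hne _ _ (by decide))
    (hne _ _ (by decide)) (φ 3) (hK 0 0) (hK 1 0) (hK 2 0) (φ 4) (hK 0 1) (hK 1 1) (hK 2 1)
    (hne _ _ (by decide)) (φ 5) (hK 0 2) (hK 1 2) (hK 2 2)
  rcases this with e | e
  · exact hne _ _ (by decide) e
  · exact hne _ _ (by decide) e

theorem tri_kur (j : ℕ) : ¬ IsMinor (gr (kur j).1 (kur j).2) tri := by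
  have h : kur j = (4, 549790) ∨ kur j = (5, 233016) := by
    unfold kur
    split
    · exact Or.inl rfl
    · exact Or.inr rfl
  rcases h with h | h
  · rw [h]
    exact tri_K5
  · rw [h]
    exact tri_K33

/-- The cone over the triangulation. -/
abbrev cone : SimpleGraph (Option (Fin 9)) := stack tri (Set.univ)

theorem cone_linkless : IsLinkless cone := by
  rw [linkless_iff]
  rintro i ⟨f, hf'⟩
  have hf : IsModel _ _ f := hf'
  have hw : ∃ w, ∀ z, z ≠ w → none ∉ f z := by
    by_cases h : ∃ w, none ∈ f w
    · obtain ⟨w, hw⟩ := h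
      exact ⟨w, fun z hz hz' => hz (hf.eq_of_mem hz' hw)⟩
    · push Not at h
      exact ⟨0, fun z _ => h z⟩
  obtain ⟨w, hw⟩ := hw
  obtain ⟨t, _, _, _, hj, h0, h1, h2, h3⟩ := fact_K i w
  have hs := model_of_star (gr (kur t.2.2.1).1 (kur t.2.2.1).2) (pet i) (pet i).Adj
    (fun _ _ h => h) (fun a => pm (fk i) t.2.2.2.1 a) (fun x => dig t.2.2.2.2 x) h1 h2 h3
  refine tri_kur t.2.2.1 (model_unstack (hs.trans hf) ?_)
  rintro a ⟨b, hb, hb'⟩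
  have hbw : b = w := by
    by_contra hne
    exact hw b hne hb'
  subst hbw
  have h4 : dig t.2.2.2.2 b = a.1 := hb
  have h5 : (kur t.2.2.1).1 ≤ 5 := by
    unfold kur; split <;> simp
  omega

theorem addEdge_comm {V : Type} (G : SimpleGraph V) (a b : V) : addEdge G a b = addEdge G b a := by
  ext x y
  simp only [addEdge_adj]
  tauto

theorem cone_max : IsMaxnil cone := by
  refine ⟨cone_linkless, ?_⟩
  have key : ∀ a b : Fin 9, a < b → ¬ tri.Adj a b →
      ¬ IsLinkless (addEdge cone (some a) (some b)) := by
    intro a b hab hn hl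
    obtain ⟨t, _, _, _, h1, h2, h3⟩ := fact_M a b hab hn
    refine hl _ .k6 ⟨_, model_of_star _ _ (RM a b) ?_ (fun w => op (dig t.2.2.1 w))
      (fun x => dig t.2.2.2 (po x)) h1 h2 (fun w w' h => h3 w w' h.ne)⟩
    intro x y h
    rw [addEdge_adj]
    obtain _ | x := x <;> obtain _ | y := y
    · exact absurd h id
    · exact Or.inl trivial
    · exact Or.inl trivial
    · rcases h with h | ⟨rfl, rfl⟩ | ⟨rfl, rfl⟩
      · exact Or.inl h
      · exact Or.inr ⟨by simpa using hab.ne, Or.inl ⟨rfl, rfl⟩⟩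
      · exact Or.inr ⟨by simpa using hab.ne', Or.inr ⟨rfl, rfl⟩⟩
  rintro (_ | a) (_ | b) hne hn
  · exact absurd rfl hne
  · exact absurd trivial hn
  · exact absurd trivial hn
  · have hab : a ≠ b := fun e => hne (e ▸ rfl)
    rcases lt_or_gt_of_ne hab with h | h
    · exact key a b h hn
    · rw [addEdge_comm]
      exact key b a h (fun h' => hn h'.symm)

/-! ### Stacking preserves linklessness and maximality -/

theorem linkless_stack {V : Type} [Nonempty V] {G : SimpleGraph V} {S : Finset V}
    (hG : IsLinkless G) (hS : G.IsClique (S : Set V))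
    (hc : S.card ≤ 3 ∨ (S.card ≤ 4 ∧ ∃ v ∈ S,
      (∀ x y, G.Adj v x → G.Adj v y → x ≠ y → G.Adj x y) ∧
      (∀ x y, G.Adj v x → G.Adj v y → x ∉ S → y ∉ S → x = y))) :
    IsLinkless (stack G (S : Set V)) := by
  classical
  rw [linkless_iff]
  rintro i ⟨f, hf'⟩
  have hf : IsModel _ _ f := hf'
  rcases stack_cases hS hf with h | ⟨w, hw⟩
  · exact hG _ (pet_mem i) h
  have hnone : ∀ z, z ≠ w → none ∉ f z := fun z hz h => hz (hf.eq_of_mem h (hw ▸ rfl))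
  have hex : ∀ z, ∃ s, (pet i).Adj w z → s ∈ S ∧ some s ∈ f z := by
    intro z
    by_cases h : (pet i).Adj w z
    · obtain ⟨a, ha, b, hb, hab⟩ := hf.2.2.2 h
      rw [hw] at ha
      obtain rfl : a = none := ha
      obtain _ | b := b
      · exact absurd rfl hab.ne
      · exact ⟨b, fun _ => ⟨hab, hb⟩⟩
    · exact ⟨Classical.arbitrary V, fun h' => absurd h' h⟩
  choose s hs using hex
  have hinj : ∀ z z', (pet i).Adj w z → (pet i).Adj w z' → s z = s z' → z = z' := by
    intro z z' h h' e
    exact hf.eq_of_mem (hs z h).2 (e ▸ (hs z' h').2)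
  have hmem : ∀ z, z ∈ nb i w ↔ (pet i).Adj w z := fun z => by simp [nb]
  have himg : (nb i w).image s ⊆ S := by
    intro x hx
    obtain ⟨z, hz, rfl⟩ := Finset.mem_image.1 hx
    exact (hs z ((hmem z).1 hz)).1
  have hcard : ((nb i w).image s).card = (nb i w).card := by
    apply Finset.card_image_of_injOn
    intro z hz z' hz' e
    exact hinj z z' ((hmem z).1 hz) ((hmem z').1 hz') e
  have hle : (nb i w).card ≤ S.card := hcard ▸ Finset.card_le_card himg
  have hdeg := fact_deg i w
  by_cases h3 : (nb i w).card = 3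
  · obtain ⟨t, _, _, _, hj, h1, h2, h4, _⟩ := fact_Y i w h3
    have hm : IsModel (pet t.2.2.1) (stack G (S : Set V)) (fun x => f (pm (fk i) t.2.2.2 x)) := by
      refine ⟨fun x => hf.1 _, fun x => hf.2.1 _, fun x y hxy => hf.2.2.1 (fun e => hxy (h2 _ _ e)),
        ?_⟩
      intro x y hxy
      rcases (h1 x y).1 hxy with h | ⟨hne, hx, hy⟩
      · exact hf.2.2.2 h
      · refine ⟨_, (hs _ hx).2, _, (hs _ hy).2, ?_⟩
        exact hS (hs _ hx).1 (hs _ hy).1 (fun e => hne (h2 _ _ (hinj _ _ hx hy e)))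
    exact hG _ (pet_mem ⟨_, hj⟩) (model_unstack hm (fun x => hnone _ (h4 x)))
  · obtain hc | ⟨hc, v, hv, hcl, hsub⟩ := hc
    · omega
    have h4 : (nb i w).card = 4 := by omega
    have heq : (nb i w).image s = S := Finset.eq_of_subset_of_card_le himg (by omega)
    have hsurj : ∀ x ∈ S, ∃ z, (pet i).Adj w z ∧ s z = x := by
      intro x hx
      rw [← heq] at hx
      obtain ⟨z, hz, rfl⟩ := Finset.mem_image.1 hx
      exact ⟨z, (hmem z).1 hz, rfl⟩
    obtain ⟨z0, hz0, hv0⟩ := hsurj v hv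
    have hvf : some v ∈ f z0 := hv0 ▸ (hs z0 hz0).2
    have hnw : z0 ≠ w := hz0.ne'
    by_cases hA : f z0 = {some v}
    · have h2 := fact_four i w h4 z0 hz0
      obtain ⟨z1, hz1, z2, hz2, hne⟩ := Finset.one_lt_card.1 h2
      have get : ∀ z, ((pet i).Adj z0 z ∧ z ≠ w ∧ ¬ (pet i).Adj w z) →
          ∃ y, some y ∈ f z ∧ G.Adj v y ∧ y ∉ S := by
        rintro z ⟨ha, hzw, hna⟩
        obtain ⟨a, ha', b, hb, hab⟩ := hf.2.2.2 ha
        rw [hA] at ha'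
        obtain rfl : a = some v := ha'
        obtain _ | b := b
        · exact absurd hb (hnone z hzw)
        · refine ⟨b, hb, hab, fun hbS => ?_⟩
          obtain ⟨z', hz', rfl⟩ := hsurj b hbS
          exact hna (hf.eq_of_mem hb (hs z' hz').2 ▸ hz')
      obtain ⟨y1, hy1, ha1, hn1⟩ := get z1 (Finset.mem_filter.1 hz1).2
      obtain ⟨y2, hy2, ha2, hn2⟩ := get z2 (Finset.mem_filter.1 hz2).2
      obtain rfl := hsub y1 y2 ha1 ha2 hn1 hn2
      exact hne (hf.eq_of_mem hy1 hy2)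
    · have hB : ∃ o ∈ f z0, some v ≠ o := by
        by_contra hcon
        push Not at hcon
        exact hA (Set.eq_singleton_iff_unique_mem.2 ⟨hvf, fun o ho => (hcon o ho).symm⟩)
      obtain ⟨o, ho, hne⟩ := hB
      obtain ⟨d, hd, hvd⟩ := exists_nbr (hf.2.1 z0) hvf ho hne
      obtain _ | d := d
      · exact hnone z0 hnw hd
      have hvd : G.Adj v d := hvd
      refine hG _ (pet_mem i) ⟨_, hf.map (fun o => match o with
        | none => v
        | some x => if x = v then d else x) ?_ ?_⟩
      · rintro a b (_ | x) hx (_ | y) hy h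
        · exact absurd rfl h.ne
        · by_cases hyv : y = v
          · right; simpa [hyv] using hvd
          · right; simpa [hyv] using hS hv h (Ne.symm hyv)
        · by_cases hxv : x = v
          · right; simpa [hxv] using hvd.symm
          · right; simpa [hxv] using hS h hv hxv
        · have h : G.Adj x y := h
          by_cases hxv : x = v
          · subst hxv
            have hyv : y ≠ x := h.ne'
            by_cases hdy : d = y
            · left; simp [hyv, hdy]
            · right; simpa [hyv] using hcl d y hvd h hdy
          · by_cases hyv : y = v
            · subst hyv
              by_cases hdx : d = x
              · left; simp [hxv, hdx]
              · right; simpa [hxv] using (hcl d x hvd h.symm hdx).symm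
            · right; simpa [hxv, hyv] using h
      · rintro a b hab (_ | x) hx (_ | y) hy e
        · exact hab (hf.eq_of_mem hx hy)
        · by_cases hyv : y = v
          · simp [hyv] at e; exact hvd.ne e
          · simp [hyv] at e; exact hyv e.symm
        · by_cases hxv : x = v
          · simp [hxv] at e; exact hvd.ne e.symm
          · simp [hxv] at e
        · by_cases hxv : x = v
          · subst hxv
            by_cases hyv : y = x
            · subst hyv; exact hab (hf.eq_of_mem hx hy)
            · simp [hyv] at e
              subst e
              exact hab ((hf.eq_of_mem hx hvf).trans (hf.eq_of_mem hd hy))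
          · by_cases hyv : y = v
            · subst hyv
              simp [hxv] at e
              subst e
              exact hab ((hf.eq_of_mem hx hd).trans (hf.eq_of_mem hvf hy))
            · simp [hxv, hyv] at e
              subst e
              exact hab (hf.eq_of_mem hx hy)

theorem stack_max {V : Type} {G : SimpleGraph V} {S : Set V} (hG : IsMaxnil G)
    (hl : IsLinkless (stack G S))
    (hx : ∀ x, x ∉ S → (∀ s ∈ S, G.Adj x s) →
      ¬ IsLinkless (addEdge (stack G S) none (some x))) : IsMaxnil (stack G S) := by
  refine ⟨hl, ?_⟩
  have key : ∀ x, x ∉ S → ¬ IsLinkless (addEdge (stack G S) none (some x)) := by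
    intro x hxS
    by_cases h : ∀ s ∈ S, G.Adj x s
    · exact hx x hxS h
    · push Not at h
      obtain ⟨s, hs, hn⟩ := h
      have h1 := hG.2 x s (fun e => hxS (e ▸ hs)) hn
      rw [IsLinkless.not_iff] at h1 ⊢
      obtain ⟨W, P, hP, hm⟩ := h1
      exact ⟨W, P, hP, stack_route hs hm⟩
  rintro (_ | a) (_ | b) hne hn
  · exact absurd rfl hne
  · exact key b hn
  · rw [addEdge_comm]
    exact key a hn
  · have h1 := hG.2 a b (fun e => hne (e ▸ rfl)) hn
    rw [IsLinkless.not_iff] at h1 ⊢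
    obtain ⟨W, P, hP, hm⟩ := h1
    refine ⟨W, P, hP, hm.map_inj some (Option.some_injective _) ?_⟩
    intro x y h
    rw [addEdge_adj] at h ⊢
    rcases h with h | ⟨h1, h2⟩
    · exact Or.inl h
    · right
      simpa using ⟨h1, h2⟩

theorem IsMinor.rfl {V : Type} (G : SimpleGraph V) : IsMinor G G := by
  refine ⟨fun v => {v}, fun v => ⟨v, Set.mem_singleton v⟩, ?_, ?_, ?_⟩
  · intro v
    refine conn_of_root v (Set.mem_singleton v) ?_
    rintro y (hy : y = v)
    subst hy
    exact Relation.ReflTransGen.refl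
  · intro v w h
    simpa using h
  · intro v w h
    exact ⟨v, Set.mem_singleton v, w, Set.mem_singleton w, h⟩

theorem minor_of_clique {V : Type} {G : SimpleGraph V} {T : Finset V} (hT : G.IsClique (T : Set V))
    (hc : T.card = 6) : IsMinor (⊤ : SimpleGraph (Fin 6)) G := by
  let e := T.equivFinOfCardEq hc
  refine (IsMinor.rfl _).map_inj (fun i => (e.symm i : V)) ?_ ?_
  · intro i j h
    exact e.symm.injective (Subtype.ext h)
  · intro i j h
    exact hT (e.symm i).2 (e.symm j).2 (fun hij => h.ne (e.symm.injective (Subtype.ext hij)))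

/-- The inductive invariant. -/
structure Good {V : Type} (G : SimpleGraph V) : Prop where
  max : IsMaxnil G
  pair : ∃ p q, p ≠ q ∧ ¬ G.Adj p q ∧ ¬ IsMinor (⊤ : SimpleGraph (Fin 6)) (addEdge G p q)
  face : ∃ S : Finset V, S.card = 4 ∧ G.IsClique (S : Set V) ∧ ∃ v ∈ S,
      (∀ x y, G.Adj v x → G.Adj v y → x ≠ y → G.Adj x y) ∧
      (∀ x y, G.Adj v x → G.Adj v y → x ∉ S → y ∉ S → x = y)

theorem Good.step {V : Type} {G : SimpleGraph V} (h : Good G) :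
    ∃ S : Set V, Good (stack G S) := by
  classical
  obtain ⟨hmax, ⟨p, q, hpq, hn, hk⟩, S, hcard, hS, v, hv, hcl, hsub⟩ := h
  have : Nonempty V := ⟨v⟩
  refine ⟨S, stack_max hmax (linkless_stack hmax.1 hS (Or.inr ⟨hcard.le, v, hv, hcl, hsub⟩)) ?_,
    ⟨some p, some q, by simpa using hpq, hn, ?_⟩, ?_⟩
  · intro x hx hadj hl
    refine hl _ .k6 (minor_of_clique (T := insert none (insert (some x)
      (S.map Function.Embedding.some))) ?_ ?_)
    · intro a ha b hb hab
      rw [addEdge_adj]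
      obtain _ | a := a <;> obtain _ | b := b
      · exact absurd rfl hab
      · by_cases hbx : b = x
        · right; simp [hbx]
        · left
          have : b ∈ S := by simpa [hbx] using hb
          exact this
      · by_cases hax : a = x
        · right; simp [hax]
        · left
          have : a ∈ S := by simpa [hax] using ha
          exact this
      · left
        change G.Adj a b
        have ha' : a = x ∨ a ∈ S := by simpa using ha
        have hb' : b = x ∨ b ∈ S := by simpa using hb
        have hab : a ≠ b := fun e => hab (e ▸ rfl)
        rcases ha' with rfl | ha' <;> rcases hb' with rfl | hb'
        · exact absurd rfl hab
        · exact hadj b hb'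
        · exact (hadj a ha').symm
        · exact hS ha' hb' hab
    · have hx : x ∉ S := hx
      rw [Finset.card_insert_of_notMem (by simp), Finset.card_insert_of_notMem (by simpa using hx),
        Finset.card_map, hcard]
  · intro hm
    refine hk (k6_stack (S := S) ?_ hcard.le (hm.map_inj id Function.injective_id ?_))
    · intro a ha b hb hab
      exact (addEdge_adj _ _ _ _ _).2 (Or.inl (hS ha hb hab))
    · rintro (_ | a) (_ | b) h <;> rw [addEdge_adj] at h
      · exact absurd rfl (h.elim (fun h => h.ne) (fun h => h.1))
      · have h : (stack G (S : Set V)).Adj none (some b) := by simpa using h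
        exact h
      · have h : (stack G (S : Set V)).Adj (some a) none := by simpa using h
        exact h
      · change (addEdge G p q).Adj a b
        rw [addEdge_adj]
        rcases h with h | h
        · exact Or.inl h
        · right
          simpa using h
  · obtain ⟨c, hc⟩ : ∃ c, c ∈ S := ⟨v, hv⟩
    refine ⟨insert none ((S.erase c).map Function.Embedding.some), ?_, ?_, none, by simp, ?_, ?_⟩
    · rw [Finset.card_insert_of_notMem (by simp), Finset.card_map, Finset.card_erase_of_mem hc,
        hcard]
    · intro a ha b hb hab
      obtain _ | a := a <;> obtain _ | b := b
      · exact absurd rfl hab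
      · have : b ∈ S ∧ ¬ b = c := by simpa using hb
        exact this.1
      · have : a ∈ S ∧ ¬ a = c := by simpa using ha
        exact this.1
      · have ha : a ∈ S ∧ ¬ a = c := by simpa using ha
        have hb : b ∈ S ∧ ¬ b = c := by simpa using hb
        exact hS ha.1 hb.1 (fun e => hab (e ▸ rfl))
    · rintro (_ | a) (_ | b) ha hb hab
      · exact absurd rfl hab
      · exact absurd rfl ha.ne
      · exact absurd rfl hb.ne
      · exact hS ha hb (fun e => hab (e ▸ rfl))
    · have key : ∀ a : V, (stack G (S : Set V)).Adj none (some a) →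
          some a ∉ insert none ((S.erase c).map Function.Embedding.some) → a = c := by
        intro a ha hn
        have ha : a ∈ S := ha
        by_contra hne
        apply hn
        simp [hne, ha]
      rintro (_ | a) (_ | b) ha hb hna hnb
      · rfl
      · exact absurd rfl ha.ne
      · exact absurd rfl hb.ne
      · rw [key a ha hna, key b hb hnb]

/-! ### The base graph -/

/-- The face on which the last vertex is stacked. -/
abbrev face0 : Finset (Option (Fin 9)) := {some 6, some 7, some 8}

/-- Adjacency in the base graph with an edge added. -/
def RB (x y : Option (Option (Fin 9))) : Bool :=
  match x, y with
    | none, none => false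
    | none, some none => true
    | some none, none => true
    | some none, some none => false
    | none, some (some i) => decide (6 ≤ i.1)
    | some (some i), none => decide (6 ≤ i.1)
    | some none, some (some _) => true
    | some (some _), some none => true
    | some (some i), some (some j) => decide (tri.Adj i j)

/-- The blocks of the model in the base graph. -/
def gB (x : Option (Option (Fin 9))) : ℕ :=
  match x with
    | none => 0
    | some none => 6
    | some (some i) => if i.1 < 3 then 1 else if i.1 < 6 then 2 else i.1 - 3

/-- The roots of the model in the base graph. -/
def rB (w : Fin 7) : Option (Option (Fin 9)) :=
  ![none, some (some 0), some (some 3), some (some 6), some (some 7), some (some 8), some none] w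

theorem fact_B1 : ∀ w : Fin 7, gB (rB w) = w := by decide +kernel
theorem fact_B2 : ∀ x, ∀ w : Fin 7, gB x = w.1 → x = rB w ∨ RB (rB w) x = true := by
  decide +kernel
theorem fact_B3 : ∀ w w' : Fin 7, (gr 6 8692579448).Adj w w' →
    ∃ x y, gB x = w.1 ∧ gB y = w'.1 ∧ RB x y = true := by decide +kernel
theorem fact_B4 : ∀ i : Fin 9, tri.Adj i 6 → tri.Adj i 7 → tri.Adj i 8 → False := by
  decide +kernel
theorem fact_B5 : ∀ i : Fin 9, 6 ≤ i.1 → i = 6 ∨ i = 7 ∨ i = 8 := by decide +kernel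
theorem fact_B6 : tri.Adj 6 7 ∧ tri.Adj 6 8 ∧ tri.Adj 7 8 := by decide +kernel

theorem face0_clique : cone.IsClique (face0 : Set (Option (Fin 9))) := by
  obtain ⟨h1, h2, h3⟩ := fact_B6
  intro a ha b hb hab
  have ha : a = some 6 ∨ a = some 7 ∨ a = some 8 := by simpa using ha
  have hb : b = some 6 ∨ b = some 7 ∨ b = some 8 := by simpa using hb
  rcases ha with rfl | rfl | rfl <;> rcases hb with rfl | rfl | rfl
  · exact absurd rfl hab
  · exact h1
  · exact h2
  · exact h1.symm
  · exact absurd rfl hab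
  · exact h3
  · exact h2.symm
  · exact h3.symm
  · exact absurd rfl hab

theorem base_p7 : IsMinor (pet 1) (addEdge (stack cone (face0 : Set (Option (Fin 9)))) none
    (some none)) := by
  refine ⟨_, model_of_star _ _ (fun x y => RB x y = true) ?_ rB gB fact_B1 fact_B2 fact_B3⟩
  have hf : ∀ i : Fin 9, 6 ≤ i.1 → some i ∈ (face0 : Set (Option (Fin 9))) := by
    intro i hi
    rcases fact_B5 i hi with rfl | rfl | rfl <;> simp
  intro x y h
  rw [addEdge_adj]
  obtain _ | _ | i := x <;> obtain _ | _ | j := y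
  · simp [RB] at h
  · right; simp
  · left; exact hf j (by simpa [RB] using h)
  · right; simp
  · simp [RB] at h
  · left; exact trivial
  · left; exact hf i (by simpa [RB] using h)
  · left; exact trivial
  · left
    have : tri.Adj i j := by simpa [RB] using h
    exact this

theorem base_good : Good (stack cone (face0 : Set (Option (Fin 9)))) := by
  classical
  have hnm : ∀ x : Option (Fin 9), x ∉ face0 → (∀ s ∈ face0, cone.Adj x s) → x = none := by
    rintro (_ | i) _ h
    · rfl
    · exact (fact_B4 i (h (some 6) (by simp)) (h (some 7) (by simp)) (h (some 8) (by simp))).elim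
  refine ⟨stack_max cone_max (linkless_stack cone_linkless face0_clique (Or.inl ?_)) ?_,
    ⟨none, some none, by simp, ?_, ?_⟩, ?_⟩
  · decide
  · intro x hx hadj hl
    obtain rfl := hnm x hx hadj
    exact hl _ (pet_mem 1) base_p7
  · intro h
    have h : (none : Option (Fin 9)) ∈ face0 := h
    simp at h
  · intro hm
    refine cone_linkless _ .k6 (k6_stack (S := insert none face0) ?_ (by decide)
      (hm.map_inj id Function.injective_id ?_))
    · rw [Finset.coe_insert]
      refine SimpleGraph.IsClique.insert face0_clique ?_
      rintro (_ | b) _ hne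
      · exact absurd rfl hne
      · trivial
    · rintro (_ | a) (_ | b) h <;> rw [addEdge_adj] at h
      · exact absurd rfl (h.elim (fun h => h.ne) (fun h => h.1))
      · rcases h with h | ⟨_, h⟩
        · have h : b ∈ face0 := h
          have h' : b ∈ insert none face0 := Finset.mem_insert_of_mem h
          exact Finset.mem_coe.2 h'
        · have : b = none := by simpa using h
          subst this
          exact Finset.mem_coe.2 (Finset.mem_insert_self none face0)
      · rcases h with h | ⟨_, h⟩
        · have h : a ∈ face0 := h
          have h' : a ∈ insert none face0 := Finset.mem_insert_of_mem h
          exact Finset.mem_coe.2 h'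
        · have : a = none := by simpa using h
          subst this
          exact Finset.mem_coe.2 (Finset.mem_insert_self none face0)
      · rcases h with h | ⟨_, h⟩
        · exact h
        · simp at h
  · refine ⟨insert none (face0.map Function.Embedding.some), ?_, ?_, none, by simp, ?_, ?_⟩
    · decide
    · rintro (_ | a) ha (_ | b) hb hab
      · exact absurd rfl hab
      · have hb : b ∈ face0 := by simpa using hb
        exact hb
      · have ha : a ∈ face0 := by simpa using ha
        exact ha
      · have hb : b ∈ face0 := by simpa using hb
        have ha : a ∈ face0 := by simpa using ha
        exact face0_clique ha hb (fun e => hab (e ▸ rfl))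
    · rintro (_ | a) (_ | b) ha hb hab
      · exact absurd rfl hab
      · exact absurd rfl ha.ne
      · exact absurd rfl hb.ne
      · exact face0_clique ha hb (fun e => hab (e ▸ rfl))
    · rintro (_ | a) _ ha _ hna _
      · exact absurd rfl ha.ne
      · have ha : a ∈ face0 := ha
        exact absurd (Finset.mem_insert_of_mem (Finset.mem_map_of_mem _ ha)) hna

theorem good_exists (m : ℕ) : ∃ (V : Type) (_ : Fintype V) (G : SimpleGraph V),
    Fintype.card V = 11 + m ∧ Good G := by
  induction m with
  | zero => exact ⟨_, inferInstance, _, by simp, base_good⟩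
  | succ m ih =>
    obtain ⟨V, _, G, hcard, hG⟩ := ih
    obtain ⟨S, hS⟩ := hG.step
    exact ⟨Option V, inferInstance, _, by simp [hcard]; omega, hS⟩

/-- For every `n ≥ 11` there exists a graph on `n` vertices that is maxnil but is not
maximal without a `K₆` minor. -/
theorem stmt_15 (n : ℕ) (hn : 11 ≤ n) :
    ∃ G : SimpleGraph (Fin n), IsMaxnil G ∧ ¬ IsMaximalK6MinorFree G := by
  obtain ⟨m, rfl⟩ := Nat.exists_eq_add_of_le hn
  obtain ⟨V, _, G, hcard, hG⟩ := good_exists m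
  let e : V ≃ Fin (11 + m) := Fintype.equivFinOfCardEq hcard
  have hto : ∀ a b x y, (addEdge G (e.symm a) (e.symm b)).Adj x y →
      (addEdge (G.comap e.symm) a b).Adj (e x) (e y) := by
    intro a b x y h
    rw [addEdge_adj] at h ⊢
    simpa [Equiv.eq_symm_apply] using h
  have hfrom : ∀ a b x y, (addEdge (G.comap e.symm) a b).Adj x y →
      (addEdge G (e.symm a) (e.symm b)).Adj (e.symm x) (e.symm y) := by
    intro a b x y h
    rw [addEdge_adj] at h ⊢
    simpa using h
  refine ⟨G.comap e.symm, ⟨?_, ?_⟩, ?_⟩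
  · intro W P hP hm
    exact hG.max.1 P hP (hm.map_inj e.symm e.symm.injective (fun x y h => h))
  · intro a b hne hadj
    have h1 := hG.max.2 (e.symm a) (e.symm b) (fun h => hne (e.symm.injective h)) hadj
    rw [IsLinkless.not_iff] at h1 ⊢
    obtain ⟨W, P, hP, hm⟩ := h1
    exact ⟨W, P, hP, hm.map_inj e e.injective (hto a b)⟩
  · intro h
    obtain ⟨p, q, hpq, hadj, hk⟩ := hG.pair
    have h1 := h.2 (e p) (e q) (e.injective.ne hpq) (by simpa using hadj)
    have h2 := h1.map_inj e.symm e.symm.injective (hfrom _ _)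
    rw [e.symm_apply_apply, e.symm_apply_apply] at h2
    exact hk h2
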